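/- arXiv:2411.08004 — 4 statements merged into one kernel-verified Lean document; each statement's English description precedes it below -/
import Mathlib

section
/- Let R be a semiprime left Goldie ring and let σ be a ring endomorphism of R with large image such that σ(C_R) ⊆ C_R. Then σ is injective. -/
/-- A two-sided ideal `I` of a ring is nilpotent if for some `n ≥ 1` every product of
`n` elements of `I` vanishes. -/
def TwoSidedIdeal.IsNilpotentIdeal {R : Type*} [Ring R] (I : TwoSidedIdeal R) : Prop :=
  ∃ n : ℕ, 0 < n ∧ ∀ f : Fin n → R, (∀ i, f i ∈ I) → (List.ofFn f).prod = 0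

/-- A ring is semiprime if it has no nonzero nilpotent two-sided ideal. -/
def IsSemiprimeRing' (R : Type*) [Ring R] : Prop :=
  ∀ I : TwoSidedIdeal R, I.IsNilpotentIdeal → I = ⊥

/-- A ring has finite left uniform dimension if it contains no infinite direct sum of
nonzero left ideals. -/
def HasFiniteLeftUniformDimension (R : Type*) [Ring R] : Prop :=
  ¬ ∃ f : ℕ → Ideal R, (∀ n, f n ≠ ⊥) ∧ iSupIndep f

/-- The left annihilator of a subset `S` of a ring. -/
def leftAnnihilator (R : Type*) [Ring R] (S : Set R) : Set R :=
  {r : R | ∀ s ∈ S, r * s = 0}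

/-- The ascending chain condition on left annihilators. -/
def ACCLeftAnnihilators (R : Type*) [Ring R] : Prop :=
  ∀ f : ℕ → Set R, (∀ n, ∃ S : Set R, f n = leftAnnihilator R S) → Monotone f →
    ∃ N, ∀ n, N ≤ n → f n = f N

/-- A ring is a left Goldie ring if it has finite left uniform dimension and satisfies
the a.c.c. on left annihilators. -/
def IsLeftGoldieRing (R : Type*) [Ring R] : Prop :=
  HasFiniteLeftUniformDimension R ∧ ACCLeftAnnihilators R

/-- A left ideal is essential if it meets every nonzero left ideal nontrivially. -/
def IsEssentialLeftIdeal {R : Type*} [Ring R] (I : Ideal R) : Prop :=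
  ∀ J : Ideal R, J ≠ ⊥ → I ⊓ J ≠ ⊥

/-- A ring endomorphism has large image if its image contains an essential left ideal. -/
def HasLargeImage {R : Type*} [Ring R] (σ : R →+* R) : Prop :=
  ∃ I : Ideal R, IsEssentialLeftIdeal I ∧ (I : Set R) ⊆ Set.range σ

/-- The left uniform dimension of a module, with values in `ℕ∞`: the supremum of the
numbers `k` such that `M` contains a direct sum of `k` nonzero submodules. -/
noncomputable def udim (R : Type*) [Ring R] (M : Type*) [AddCommGroup M] [Module R M] : ℕ∞ :=
  sSup {n : ℕ∞ | ∃ (k : ℕ) (f : Fin k → Submodule R M),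
    n = (k : ℕ∞) ∧ (∀ i, f i ≠ ⊥) ∧ iSupIndep f}

/-- `DevLE α P` means that the deviation of the poset `P` is at most the ordinal `α`:
for every descending chain, all but finitely many of its factor intervals either are
trivial or have deviation at most some ordinal `β < α`. -/
def DevLE (α : Ordinal.{v}) (P : Type u) [Preorder P] : Prop :=
  ∀ f : ℕ → P, (∀ n, f (n + 1) ≤ f n) →
    ∃ N : ℕ, ∀ n, N ≤ n →
      (∀ x y : Set.Icc (f (n + 1)) (f n), x ≤ y → y ≤ x) ∨
      ∃ (β : Ordinal.{v}) (_ : β < α), DevLE β (Set.Icc (f (n + 1)) (f n))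
termination_by α

/-- A module has (Gabriel–Rentschler) Krull dimension if the deviation of its lattice of
submodules is defined, i.e. bounded by some ordinal. -/
def HasKrullDimGR (R : Type u) [Ring R] (M : Type v) [AddCommGroup M] [Module R M] : Prop :=
  ∃ α : Ordinal.{max u v}, DevLE α (Submodule R M)

/-- The Gabriel–Rentschler Krull dimension of a module: the least ordinal bounding the
deviation of its lattice of submodules. -/
noncomputable def krullDimGR (R : Type u) [Ring R] (M : Type v) [AddCommGroup M]
    [Module R M] : Ordinal.{max u v} :=
  sInf {α : Ordinal.{max u v} | DevLE α (Submodule R M)}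

section Ore

variable {R : Type*} [Ring R]

/-- A multiplicative subset: contains `1`, omits `0` and is closed under multiplication. -/
def IsMultSet (S : Set R) : Prop :=
  1 ∈ S ∧ 0 ∉ S ∧ ∀ s ∈ S, ∀ t ∈ S, s * t ∈ S

/-- A left Ore set: a multiplicative set satisfying the left Ore condition. -/
def IsLeftOreSet (S : Set R) : Prop :=
  IsMultSet S ∧ ∀ (r : R), ∀ s ∈ S, ∃ s' ∈ S, ∃ r' : R, s' * r = r' * s

/-- `assL S = { r | s r = 0 for some s ∈ S }`. -/
def assL (S : Set R) : Set R := {r : R | ∃ s ∈ S, s * r = 0}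

/-- A left denominator set: a left Ore set such that `r s = 0` with `s ∈ S` implies
`t r = 0` for some `t ∈ S`. -/
def IsLeftDenominatorSet (S : Set R) : Prop :=
  IsLeftOreSet S ∧ ∀ (r : R), ∀ s ∈ S, r * s = 0 → ∃ t ∈ S, t * r = 0

/-- `θ : R →+* Q` realizes `Q` as the left localization `S⁻¹R` of `R` at `S`:
elements of `S` become units, the kernel of `θ` is `assL S`, and every element of `Q`
has the form `θ(s)⁻¹ θ(r)`. -/
structure IsLeftLocalization {Q : Type*} [Ring Q] (S : Set R) (θ : R →+* Q) : Prop where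
  isUnit : ∀ s ∈ S, IsUnit (θ s)
  ker_eq : ∀ r : R, θ r = 0 ↔ r ∈ assL S
  exists_rep : ∀ q : Q, ∃ s ∈ S, ∃ r : R, θ s * q = θ r

end Ore

section SemiprimeGoldie

variable {R : Type*} [Ring R]

theorem iSupIndep_of_disjoint_filtration {ι : Type*} [LinearOrder ι] {f G : ι → Ideal R}
    (hdisj : ∀ i, Disjoint (f i) (G i)) (hle : ∀ i j, j < i → f j ≤ G i) : iSupIndep f := by
  classical
  rw [iSupIndep_iff_finsetSum_eq_zero_imp_eq_zero]
  intro s v hmem hsum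
  by_contra! hne
  obtain ⟨i₀, hi₀, hi₀'⟩ := hne
  let t := s.filter fun i => v i ≠ 0
  have ht : t.Nonempty := ⟨i₀, by simp [t, hi₀, hi₀']⟩
  obtain ⟨m, hm, hmax⟩ := t.exists_max_image id ht
  have hms : m ∈ s ∧ v m ≠ 0 := by simpa [t] using hm
  have hrest : ∑ i ∈ s.erase m, v i ∈ G m := by
    refine Submodule.sum_mem _ fun i hi => ?_
    rw [Finset.mem_erase] at hi
    by_cases h0 : v i = 0
    · simp [h0]
    · have hle' : i ≤ m := hmax i (by simp [t, hi.2, h0])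
      exact hle m i (lt_of_le_of_ne hle' hi.1) (hmem i hi.2)
  have hvm : v m = -∑ i ∈ s.erase m, v i := by
    rw [← Finset.add_sum_erase s v hms.1] at hsum
    exact eq_neg_of_add_eq_zero_left hsum
  refine hms.2 (Submodule.disjoint_def.mp (hdisj m) _ (hmem m hms.1) ?_)
  rw [hvm]
  exact neg_mem hrest

theorem mem_leftAnnihilator_singleton {a r : R} :
    r ∈ leftAnnihilator R {a} ↔ r * a = 0 := by
  simp [leftAnnihilator]

theorem ACCLeftAnnihilators.exists_maximal (h : ACCLeftAnnihilators R) {P : R → Prop}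
    (hP : ∃ a, P a) :
    ∃ a, P a ∧ ∀ b, P b → (∀ r, r * a = 0 → r * b = 0) → ∀ r, r * b = 0 → r * a = 0 := by
  have hwf : WellFoundedGT {A : Set R // ∃ S, A = leftAnnihilator R S} := by
    rw [wellFoundedGT_iff_monotone_chain_condition]
    intro f
    obtain ⟨N, hN⟩ := h (fun n => (f n).1) (fun n => (f n).2) (fun m n hmn => f.monotone hmn)
    exact ⟨N, fun m hm => Subtype.ext (hN m hm).symm⟩
  obtain ⟨a₀, ha₀⟩ := hP
  let F : R → {A : Set R // ∃ S, A = leftAnnihilator R S} := fun a => ⟨_, {a}, rfl⟩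
  obtain ⟨_, ⟨a, ha, rfl⟩, hmax⟩ := hwf.wf.has_min (F '' {a | P a}) ⟨_, a₀, ha₀, rfl⟩
  refine ⟨a, ha, fun b hb hab r hr => ?_⟩
  by_contra hra
  refine hmax (F b) ⟨b, hb, rfl⟩ (lt_of_le_not_ge ?_ ?_)
  · exact fun r hr => mem_leftAnnihilator_singleton.mpr
      (hab r (mem_leftAnnihilator_singleton.mp hr))
  · intro hle
    exact hra (mem_leftAnnihilator_singleton.mp (hle (mem_leftAnnihilator_singleton.mpr hr)))

theorem ACCLeftAnnihilators.exists_pow (h : ACCLeftAnnihilators R) (b : R) :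
    ∃ n, 0 < n ∧ ∀ r, r * (b ^ n * b ^ n) = 0 → r * b ^ n = 0 := by
  obtain ⟨N, hN⟩ := h (fun n => leftAnnihilator R {b ^ (n + 1)}) (fun n => ⟨_, rfl⟩)
    (monotone_nat_of_le_succ fun n r hr => by
      rw [mem_leftAnnihilator_singleton] at hr ⊢
      rw [pow_succ, ← mul_assoc, hr, zero_mul])
  refine ⟨N + 1, N.succ_pos, fun r hr => ?_⟩
  rw [← mem_leftAnnihilator_singleton, ← hN (2 * N + 1) (by lia), mem_leftAnnihilator_singleton]
  rw [← hr, ← pow_add]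
  congr 2
  ring

theorem IsSemiprimeRing'.eq_zero_of_forall_mul_mul_eq_zero (h : IsSemiprimeRing' R) {a : R}
    (ha : ∀ r, a * r * a = 0) : a = 0 := by
  have hbot : TwoSidedIdeal.span {a} = ⊥ := by
    refine h _ ⟨2, two_pos, fun f hf => ?_⟩
    have key : ∀ x ∈ TwoSidedIdeal.span {a}, ∀ y ∈ TwoSidedIdeal.span {a}, x * y = 0 := by
      have h1 : ∀ y ∈ TwoSidedIdeal.span {a}, ∀ r, a * r * y = 0 := by
        intro y hy
        rw [TwoSidedIdeal.mem_span_iff_mem_addSubgroup_closure] at hy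
        induction hy using AddSubgroup.closure_induction with
        | mem y hy =>
          obtain ⟨_, ⟨s, -, _, rfl, rfl⟩, t, -, rfl⟩ := hy
          intro r
          have := ha (r * s)
          simp only [← mul_assoc] at this ⊢
          simp [this]
        | zero => simp
        | add x y _ _ hx hy => intro r; rw [mul_add, hx, hy, add_zero]
        | neg x _ hx => intro r; rw [mul_neg, hx, neg_zero]
      intro x hx y hy
      rw [TwoSidedIdeal.mem_span_iff_mem_addSubgroup_closure] at hx
      induction hx using AddSubgroup.closure_induction with
      | mem x hx =>
        obtain ⟨_, ⟨s, -, _, rfl, rfl⟩, t, -, rfl⟩ := hx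
        have := h1 y hy t
        simp only [mul_assoc] at this ⊢
        simp [this]
      | zero => simp
      | add x y _ _ hx hy => rw [add_mul, hx, hy, add_zero]
      | neg x _ hx => rw [neg_mul, hx, neg_zero]
    simpa using key _ (hf 0) _ (hf 1)
  have : a ∈ TwoSidedIdeal.span {a} := TwoSidedIdeal.subset_span rfl
  rwa [hbot, TwoSidedIdeal.mem_bot] at this

theorem IsSemiprimeRing'.eq_zero_of_isNilpotent_mul (h : IsSemiprimeRing' R)
    (hacc : ACCLeftAnnihilators R) {a : R} (ha : ∀ r, IsNilpotent (r * a)) : a = 0 := by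
  by_contra hne
  have ha' : ∀ r, IsNilpotent (a * r) := by
    intro r
    obtain ⟨n, hn⟩ := ha r
    have hswap : ∀ k, (a * r) ^ (k + 1) = a * (r * a) ^ k * r := by
      intro k
      induction k with
      | zero => simp
      | succ k ih => rw [pow_succ', ih, pow_succ' (r * a)]; simp only [mul_assoc]
    exact ⟨n + 1, by rw [hswap, hn, mul_zero, zero_mul]⟩
  obtain ⟨b, ⟨hb0, x, rfl⟩, hmax⟩ := hacc.exists_maximal (P := fun b => b ≠ 0 ∧ ∃ x, b = a * x)
    ⟨a, hne, 1, by simp⟩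
  refine hb0 (h.eq_zero_of_forall_mul_mul_eq_zero fun r => ?_)
  by_cases hr : a * x * r = 0
  · rw [hr, zero_mul]
  have hnil : IsNilpotent (a * x * r) := by rw [mul_assoc]; exact ha' _
  obtain ⟨k, hk, hk'⟩ : ∃ k, (a * x * r) ^ (k + 1) ≠ 0 ∧ (a * x * r) ^ (k + 2) = 0 := by
    classical
    have hpos : 2 ≤ Nat.find hnil := by
      by_contra hlt
      have hs := Nat.find_spec hnil
      have : Nat.find hnil = 0 ∨ Nat.find hnil = 1 := by lia
      rcases this with h0 | h0
      · rw [h0, pow_zero] at hs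
        exact hr (by rw [← mul_one (a * x * r), hs, mul_zero])
      · rw [h0, pow_one] at hs
        exact hr hs
    obtain ⟨k, hk⟩ := Nat.exists_eq_add_of_le' hpos
    exact ⟨k, Nat.find_min hnil (by lia), hk ▸ Nat.find_spec hnil⟩
  refine hmax ((a * x * r) ^ (k + 1)) ⟨hk, x * r * (a * x * r) ^ k, ?_⟩ ?_ _ ?_
  · rw [pow_succ']; simp only [mul_assoc]
  · intro s hs
    rw [pow_succ', ← mul_assoc, ← mul_assoc, hs, zero_mul, zero_mul]
  · rw [← pow_succ', hk']

theorem IsSemiprimeRing'.exists_mem_of_ne_bot (h : IsSemiprimeRing' R)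
    (hacc : ACCLeftAnnihilators R) {I : Ideal R} (hI : I ≠ ⊥) :
    ∃ a ∈ I, a ≠ 0 ∧ ∀ r, r * (a * a) = 0 → r * a = 0 := by
  obtain ⟨x, hx, hx0⟩ := Submodule.exists_mem_ne_zero_of_ne_bot hI
  obtain ⟨r, hr⟩ : ∃ r, ¬ IsNilpotent (r * x) := by
    by_contra! hnil
    exact hx0 (h.eq_zero_of_isNilpotent_mul hacc hnil)
  obtain ⟨n, hn, hn'⟩ := hacc.exists_pow (r * x)
  exact ⟨(r * x) ^ n, I.pow_mem_of_mem (I.mul_mem_left r hx) n hn, fun h0 => hr ⟨n, h0⟩, hn'⟩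

theorem isEssentialLeftIdeal_iff_forall_exists {I : Ideal R} :
    IsEssentialLeftIdeal I ↔ ∀ y : R, y ≠ 0 → ∃ r, r * y ∈ I ∧ r * y ≠ 0 := by
  constructor
  · intro h y hy
    obtain ⟨z, hz, hz0⟩ := Submodule.exists_mem_ne_zero_of_ne_bot
      (h (Ideal.span {y}) (by simpa [Ideal.span_singleton_eq_bot] using hy))
    obtain ⟨r, rfl⟩ := Ideal.mem_span_singleton'.mp hz.2
    exact ⟨r, hz.1, hz0⟩
  · intro h J hJ hbot
    obtain ⟨y, hy, hy0⟩ := Submodule.exists_mem_ne_zero_of_ne_bot hJ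
    obtain ⟨r, hr, hr0⟩ := h y hy0
    have : r * y ∈ I ⊓ J := ⟨hr, J.mul_mem_left r hy⟩
    rw [hbot] at this
    exact hr0 this

/-- A semiprime ring with the a.c.c. on left annihilators is left nonsingular. -/
theorem IsSemiprimeRing'.eq_zero_of_isEssentialLeftIdeal_mul (h : IsSemiprimeRing' R)
    (hacc : ACCLeftAnnihilators R) {I : Ideal R} (hI : IsEssentialLeftIdeal I) {x : R}
    (hx : ∀ r ∈ I, r * x = 0) : x = 0 := by
  rw [isEssentialLeftIdeal_iff_forall_exists] at hI
  refine h.eq_zero_of_isNilpotent_mul hacc fun s => ?_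
  obtain ⟨n, hn, hn'⟩ := hacc.exists_pow (s * x)
  refine ⟨n, ?_⟩
  by_contra h0
  obtain ⟨m, rfl⟩ := Nat.exists_eq_succ_of_ne_zero hn.ne'
  obtain ⟨r, hr, hr0⟩ : ∃ r, r * (s * x) ^ (m + 1) * s ∈ I ∧ r * (s * x) ^ (m + 1) ≠ 0 := by
    by_cases hz : (s * x) ^ (m + 1) * s = 0
    · exact ⟨1, by simp [hz], by simpa using h0⟩
    · obtain ⟨r, hr, hr0⟩ := hI _ hz
      rw [← mul_assoc] at hr hr0
      exact ⟨r, hr, fun h0 => hr0 (by rw [h0, zero_mul])⟩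
  refine hr0 (hn' r ?_)
  have := hx _ hr
  calc r * ((s * x) ^ (m + 1) * (s * x) ^ (m + 1))
      = (r * (s * x) ^ (m + 1) * s * x) * (s * x) ^ m := by
        simp only [mul_assoc, pow_succ']
    _ = 0 := by rw [this, zero_mul]

theorem HasFiniteLeftUniformDimension.isEssentialLeftIdeal_span_singleton
    (h : HasFiniteLeftUniformDimension R) {c : R} (hc : ∀ r, r * c = 0 → r = 0) :
    IsEssentialLeftIdeal (Ideal.span {c}) := by
  intro L hL hbot
  have hpow : ∀ n r, r * c ^ n = 0 → r = 0 := by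
    intro n
    induction n with
    | zero => simp
    | succ n ih =>
      intro r hr
      rw [pow_succ, ← mul_assoc] at hr
      exact ih r (hc _ hr)
  let f : ℕ → Ideal R := fun n => Submodule.map (LinearMap.mulRight R (c ^ n) : R →ₗ[R] R) L
  refine h ⟨f, fun n hn => ?_, ?_⟩
  · obtain ⟨x, hx, hx0⟩ := Submodule.exists_mem_ne_zero_of_ne_bot hL
    have : x * c ^ n ∈ f n := ⟨x, hx, rfl⟩
    rw [hn] at this
    exact hx0 (hpow n x this)
  · have hind : iSupIndep (fun n : ℕᵒᵈ => f (OrderDual.ofDual n)) := by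
      refine iSupIndep_of_disjoint_filtration
        (G := fun n => Ideal.span {c ^ (OrderDual.ofDual n + 1)}) ?_ ?_
      · intro n
        rw [Submodule.disjoint_def]
        rintro _ ⟨x, hx, rfl⟩ hmem
        obtain ⟨r, hr⟩ := Ideal.mem_span_singleton'.mp hmem
        have hxr : x - r * c = 0 := by
          apply hpow (OrderDual.ofDual n)
          rw [pow_succ', ← mul_assoc] at hr
          rw [sub_mul, hr]
          simp
        have : x ∈ Ideal.span {c} ⊓ L :=
          ⟨Ideal.mem_span_singleton'.mpr ⟨r, (sub_eq_zero.mp hxr).symm⟩, hx⟩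
        rw [hbot, Submodule.mem_bot] at this
        simp [this]
      · rintro i j hij _ ⟨x, -, rfl⟩
        have hlt : OrderDual.ofDual i + 1 ≤ OrderDual.ofDual j := hij
        obtain ⟨k, hk⟩ := Nat.exists_eq_add_of_le' hlt
        refine Ideal.mem_span_singleton'.mpr ⟨x * c ^ k, ?_⟩
        rw [mul_assoc, ← pow_add, ← hk]
        rfl
    exact hind.comp OrderDual.toDual.injective

theorem IsSemiprimeRing'.exists_left_regular_mem (h : IsSemiprimeRing' R)
    (hG : IsLeftGoldieRing R) {E : Ideal R} (hE : IsEssentialLeftIdeal E) :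
    ∃ c ∈ E, ∀ r, r * c = 0 → r = 0 := by
  let ann : R → Ideal R := fun b => LinearMap.ker (LinearMap.mulRight R b : R →ₗ[R] R)
  have mem_ann : ∀ b r, r ∈ ann b ↔ r * b = 0 := fun b r => by simp [ann]
  by_contra! hno
  have hstep : ∀ b : {b : R // b ∈ E ∧ ∀ r, r * (b * b) = 0 → r * b = 0},
      ∃ a : R, a ∈ E ∧ a ≠ 0 ∧ a * b = 0 ∧ ∀ r, r * (a * a) = 0 → r * a = 0 := by
    rintro ⟨b, hb, -⟩
    obtain ⟨r, hr, hr0⟩ := hno b hb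
    obtain ⟨a, ha, ha0, haa⟩ := h.exists_mem_of_ne_bot hG.2
      (hE (ann b) (Submodule.ne_bot_iff _ |>.mpr ⟨r, (mem_ann b r).mpr hr, hr0⟩))
    exact ⟨a, ha.1, ha0, (mem_ann b a).mp ha.2, haa⟩
  choose a haE ha0 hab haa using hstep
  have hsum : ∀ b r, r * (b.1 + a b) = 0 → r * b.1 = 0 ∧ r * a b = 0 := by
    intro b r hr
    have hrb : r * b.1 = 0 := by
      apply b.2.2
      calc r * (b.1 * b.1) = r * (b.1 + a b) * b.1 - r * (a b * b.1) := by noncomm_ring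
        _ = 0 := by rw [hr, hab]; simp
    rw [mul_add, hrb, zero_add] at hr
    exact ⟨hrb, hr⟩
  let next : {b : R // b ∈ E ∧ ∀ r, r * (b * b) = 0 → r * b = 0} →
      {b : R // b ∈ E ∧ ∀ r, r * (b * b) = 0 → r * b = 0} := fun b =>
    ⟨b.1 + a b, add_mem b.2.1 (haE b), fun r hr => by
      rw [← mul_assoc] at hr
      obtain ⟨h1, h2⟩ := hsum b _ hr
      have hrb : r * b.1 = 0 := by
        apply b.2.2
        rwa [mul_add, add_mul, mul_assoc r (a b), hab, mul_zero, add_zero, mul_assoc] at h1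
      rw [mul_add, hrb, zero_add]
      apply haa
      rw [mul_add, hrb, zero_add, mul_assoc] at h2
      exact h2⟩
  let b : ℕ → {b : R // b ∈ E ∧ ∀ r, r * (b * b) = 0 → r * b = 0} := fun n =>
    next^[n] ⟨0, zero_mem _, by simp⟩
  have hb : ∀ n, (b (n + 1)).1 = (b n).1 + a (b n) := fun n => by
    simp only [b, Function.iterate_succ_apply', next]
  have hanti : Antitone fun n => ann (b n).1 := by
    refine antitone_nat_of_succ_le fun n r hr => ?_
    rw [mem_ann, hb] at hr
    exact (mem_ann _ _).mpr (hsum _ _ hr).1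
  refine hG.1 ⟨fun n => Ideal.span {a (b n)}, fun n => by
    simpa [Ideal.span_singleton_eq_bot] using ha0 (b n), ?_⟩
  have hind : iSupIndep (fun n : ℕᵒᵈ => Ideal.span {a (b (OrderDual.ofDual n))}) := by
    refine iSupIndep_of_disjoint_filtration
      (G := fun n => ann (b (OrderDual.ofDual n + 1)).1) ?_ ?_
    · intro n
      rw [Submodule.disjoint_def]
      intro x hx hmem
      obtain ⟨r, rfl⟩ := Ideal.mem_span_singleton'.mp hx
      rw [mem_ann, hb] at hmem
      apply haa
      rw [← mul_assoc]
      exact (hsum _ _ hmem).2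
    · intro i j hij
      have hlt : OrderDual.ofDual i + 1 ≤ OrderDual.ofDual j := hij
      refine le_trans ?_ (hanti hlt)
      rw [Ideal.span_singleton_le_iff_mem, mem_ann]
      exact hab _
  exact hind.comp OrderDual.toDual.injective

/-- In a semiprime left Goldie ring every essential left ideal contains a regular element. -/
theorem IsSemiprimeRing'.exists_isRegular_mem (h : IsSemiprimeRing' R)
    (hG : IsLeftGoldieRing R) {E : Ideal R} (hE : IsEssentialLeftIdeal E) :
    ∃ c ∈ E, IsRegular c := by
  obtain ⟨c, hcE, hc⟩ := h.exists_left_regular_mem hG hE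
  refine ⟨c, hcE, ?_, ?_⟩
  · rw [isLeftRegular_iff_right_eq_zero_of_mul]
    intro x hx
    refine h.eq_zero_of_isEssentialLeftIdeal_mul hG.2
      (hG.1.isEssentialLeftIdeal_span_singleton hc) fun r hr => ?_
    obtain ⟨s, rfl⟩ := Ideal.mem_span_singleton'.mp hr
    rw [mul_assoc, hx, mul_zero]
  · rwa [isRightRegular_iff_left_eq_zero_of_mul]

/-- If `τ` preserves regular elements, then `ker τ` is not essential in any larger left ideal. -/
theorem IsSemiprimeRing'.exists_disjoint_ker (h : IsSemiprimeRing' R)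
    (hG : IsLeftGoldieRing R) {τ : R →+* R} (hτ : ∀ c : R, IsRegular c → IsRegular (τ c))
    {J : Ideal R} {x : R} (hx : x ∈ J) (hτx : τ x ≠ 0) :
    ∃ N : Ideal R, N ≠ ⊥ ∧ N ≤ J ∧ Disjoint N (RingHom.ker τ) := by
  by_contra! hno
  let E : Ideal R := Submodule.comap (LinearMap.mulRight R x : R →ₗ[R] R) (RingHom.ker τ)
  have mem_E : ∀ r, r ∈ E ↔ τ (r * x) = 0 := fun r => by simp [E, RingHom.mem_ker]
  have hE : IsEssentialLeftIdeal E := by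
    rw [isEssentialLeftIdeal_iff_forall_exists]
    intro y hy
    by_cases hyx : y * x = 0
    · exact ⟨1, by rw [mem_E]; simp [hyx], by simpa using hy⟩
    · have hnd := hno (Ideal.span {y * x}) (by simpa [Ideal.span_singleton_eq_bot] using hyx)
        ((Ideal.span_singleton_le_iff_mem _).mpr (J.mul_mem_left y hx))
      rw [Submodule.disjoint_def] at hnd
      push Not at hnd
      obtain ⟨z, hz, hzk, hz0⟩ := hnd
      obtain ⟨r, rfl⟩ := Ideal.mem_span_singleton'.mp hz
      rw [← mul_assoc] at hzk hz0
      exact ⟨r, (mem_E _).mpr hzk, fun h0 => hz0 (by rw [h0, zero_mul])⟩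
  obtain ⟨c, hcE, hc⟩ := h.exists_isRegular_mem hG hE
  rw [mem_E, map_mul] at hcE
  exact hτx ((isLeftRegular_iff_right_eq_zero_of_mul.mp (hτ c hc).left) _ hcE)

end SemiprimeGoldie

/-- **Theorem 2.3.** Let `R` be a semiprime left Goldie ring and `σ` an endomorphism of
`R` with large image such that `σ(C_R) ⊆ C_R`. Then `σ` is a monomorphism. -/
theorem injective_of_large_of_respects_regular {R : Type*} [Ring R]
    (hsemiprime : IsSemiprimeRing' R) (hgoldie : IsLeftGoldieRing R)
    (σ : R →+* R) (hlarge : HasLargeImage σ)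
    (hreg : ∀ c : R, IsRegular c → IsRegular (σ c)) :
    Function.Injective σ := by
  rw [injective_iff_map_eq_zero]
  by_contra! hker
  obtain ⟨x₀, hx₀, hx₀'⟩ := hker
  obtain ⟨I, hI, hIσ⟩ := hlarge
  have hregpow : ∀ n, ∀ c : R, IsRegular c → IsRegular ((σ ^ n) c) := by
    intro n
    induction n with
    | zero => simp
    | succ n ih => intro c hc; rw [pow_succ]; exact ih _ (hreg c hc)
  have hmono : Monotone fun n => RingHom.ker (σ ^ n) := by
    refine monotone_nat_of_le_succ fun n x hx => ?_
    rw [RingHom.mem_ker] at hx ⊢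
    rw [pow_succ', RingHom.mul_def, RingHom.comp_apply, hx, map_zero]
  have hexists : ∀ n, ∃ N : Ideal R, N ≠ ⊥ ∧ N ≤ RingHom.ker (σ ^ (n + 1)) ∧
      Disjoint N (RingHom.ker (σ ^ n)) := by
    intro n
    induction n with
    | zero =>
      exact hsemiprime.exists_disjoint_ker hgoldie (hregpow 0) (x := x₀)
        (by simpa [RingHom.mem_ker] using hx₀) (by simpa using hx₀')
    | succ n ih =>
      obtain ⟨N, hN, hNker, hNdisj⟩ := ih
      obtain ⟨y, hy, hy0⟩ := Submodule.exists_mem_ne_zero_of_ne_bot (hI N hN)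
      obtain ⟨x, rfl⟩ := hIσ hy.1
      refine hsemiprime.exists_disjoint_ker hgoldie (hregpow (n + 1)) (x := x) ?_ ?_
      · have := hNker hy.2
        rw [RingHom.mem_ker] at this ⊢
        rwa [pow_succ]
      · intro h0
        refine hy0 (Submodule.disjoint_def.mp hNdisj _ hy.2 ?_)
        rwa [pow_succ] at h0
  choose N hN hNker hNdisj using hexists
  exact hgoldie.1 ⟨N, hN, iSupIndep_of_disjoint_filtration hNdisj
    fun i j hij => (hNker j).trans (hmono hij)⟩
end

section
/- Let R be a semiprime left Goldie ring and let R' be a subring of R containing an essential left ideal of R. Then the set of regular elements of R' equals C_R ∩ R', where C_R is the set of regular elements of R. -/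
/-- A semiprime ring has no nonzero `z` with `z R z = 0`. -/
theorem IsSemiprimeRing'.eq_zero_of_mul_mul_eq_zero {R : Type*} [Ring R]
    (h : IsSemiprimeRing' R) {z : R} (hz : ∀ a, z * a * z = 0) : z = 0 := by
  have right_zero : ∀ b ∈ TwoSidedIdeal.span {z}, ∀ r, z * r * b = 0 := by
    intro b hb
    induction hb using TwoSidedIdeal.span_induction with
    | mem x hx => rw [Set.mem_singleton_iff.1 hx]; exact hz
    | zero => simp
    | add x y _ _ hx hy => intro r; rw [mul_add, hx, hy, add_zero]
    | neg x _ hx => intro r; rw [mul_neg, hx, neg_zero]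
    | left_absorb a x _ hx => intro r; rw [← mul_assoc, mul_assoc z, hx]
    | right_absorb a x _ hx => intro r; rw [← mul_assoc, hx, zero_mul]
  have mul_zero' : ∀ a ∈ TwoSidedIdeal.span {z}, ∀ b ∈ TwoSidedIdeal.span {z}, a * b = 0 := by
    intro a ha
    induction ha using TwoSidedIdeal.span_induction with
    | mem x hx =>
      intro b hb
      rw [Set.mem_singleton_iff.1 hx]
      simpa using right_zero b hb 1
    | zero => simp
    | add x y _ _ hx hy => intro b hb; rw [add_mul, hx b hb, hy b hb, add_zero]
    | neg x _ hx => intro b hb; rw [neg_mul, hx b hb, neg_zero]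
    | left_absorb a x _ hx => intro b hb; rw [mul_assoc, hx b hb, mul_zero]
    | right_absorb a x _ hx =>
      intro b hb
      rw [mul_assoc, hx _ (TwoSidedIdeal.mul_mem_left _ _ _ hb)]
  have hbot : TwoSidedIdeal.span {z} = ⊥ :=
    h _ ⟨2, two_pos, fun f hf => by
      simpa [List.ofFn_succ] using mul_zero' _ (hf 0) _ (hf 1)⟩
  have hmem : z ∈ TwoSidedIdeal.span {z} := TwoSidedIdeal.subset_span rfl
  rwa [hbot, TwoSidedIdeal.mem_bot] at hmem

/-- The left annihilator of an element, as a left ideal. -/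
def leftAnnihilatorIdeal {R : Type*} [Ring R] (z : R) : Ideal R :=
  LinearMap.ker (LinearMap.toSpanSingleton R R z)

theorem mem_leftAnnihilatorIdeal {R : Type*} [Ring R] {z r : R} :
    r ∈ leftAnnihilatorIdeal z ↔ r * z = 0 := by
  simp [leftAnnihilatorIdeal]

theorem IsEssentialLeftIdeal.mono {R : Type*} [Ring R] {I J : Ideal R}
    (hI : IsEssentialLeftIdeal I) (hIJ : I ≤ J) : IsEssentialLeftIdeal J :=
  fun K hK h => hI K hK (le_bot_iff.1 (h ▸ inf_le_inf_right K hIJ))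

theorem IsEssentialLeftIdeal.exists_mul_mem {R : Type*} [Ring R] {I : Ideal R}
    (hI : IsEssentialLeftIdeal I) {z : R} (hz : z ≠ 0) : ∃ r, r * z ∈ I ∧ r * z ≠ 0 := by
  obtain ⟨x, ⟨hxI, hx⟩, hx0⟩ := (Submodule.ne_bot_iff _).1
    (hI (Ideal.span {z}) (by simpa [Ideal.span_singleton_eq_bot] using hz))
  obtain ⟨r, rfl⟩ := Ideal.mem_span_singleton'.1 hx
  exact ⟨r, hxI, hx0⟩

/-- The left singular elements of a ring are closed under left multiplication. -/
theorem IsEssentialLeftIdeal.leftAnnihilatorIdeal_mul_left {R : Type*} [Ring R] {z : R}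
    (hz : IsEssentialLeftIdeal (leftAnnihilatorIdeal z)) (a : R) :
    IsEssentialLeftIdeal (leftAnnihilatorIdeal (a * z)) := by
  intro J hJ
  obtain ⟨j, hj, hj0⟩ := (Submodule.ne_bot_iff _).1 hJ
  rw [Submodule.ne_bot_iff]
  by_cases hja : j * a = 0
  · exact ⟨j, ⟨mem_leftAnnihilatorIdeal.2 (by rw [← mul_assoc, hja, zero_mul]), hj⟩, hj0⟩
  · obtain ⟨r, hr, hr0⟩ := hz.exists_mul_mem hja
    refine ⟨r * j, ⟨mem_leftAnnihilatorIdeal.2 ?_, J.mul_mem_left r hj⟩, fun h => hr0 ?_⟩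
    · simpa only [mul_assoc] using mem_leftAnnihilatorIdeal.1 hr
    · rw [← mul_assoc, h, zero_mul]

/-- Under the a.c.c. on left annihilators, a nonempty set of elements contains one whose
left annihilator is maximal. -/
theorem ACCLeftAnnihilators.exists_maximal_s9 {R : Type*} [Ring R] (h : ACCLeftAnnihilators R)
    {P : R → Prop} (hP : ∃ z, P z) :
    ∃ z, P z ∧ ∀ w, P w → leftAnnihilatorIdeal z ≤ leftAnnihilatorIdeal w →
      leftAnnihilatorIdeal w ≤ leftAnnihilatorIdeal z := by
  by_contra! hmax
  obtain ⟨z₀, hz₀⟩ := hP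
  choose! next hnext hle hnot using hmax
  let z : ℕ → R := fun n => next^[n] z₀
  have hz_succ (n : ℕ) : z (n + 1) = next (z n) := Function.iterate_succ_apply' next n z₀
  have hz (n : ℕ) : P (z n) := by
    induction n with
    | zero => exact hz₀
    | succ n ih => rw [hz_succ]; exact hnext _ ih
  obtain ⟨N, hN⟩ := h (fun n => leftAnnihilatorIdeal (z n))
    (fun n => ⟨{z n}, by ext r; simp [leftAnnihilator, mem_leftAnnihilatorIdeal]⟩)
    (monotone_nat_of_le_succ fun n => by
      rw [hz_succ]; exact SetLike.coe_subset_coe.2 (hle _ (hz n)))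
  have hstab := hN (N + 1) N.le_succ
  simp only [hz_succ] at hstab
  exact hnot _ (hz N) (SetLike.coe_injective hstab).le

/-- A semiprime ring with the a.c.c. on left annihilators is left nonsingular. -/
theorem IsSemiprimeRing'.eq_zero_of_isEssentialLeftIdeal {R : Type*} [Ring R]
    (h : IsSemiprimeRing' R) (hacc : ACCLeftAnnihilators R) {y : R}
    (hy : IsEssentialLeftIdeal (leftAnnihilatorIdeal y)) : y = 0 := by
  by_contra hy0
  obtain ⟨z, ⟨hz0, hz⟩, hmax⟩ := hacc.exists_maximal_s9
    (P := fun z => z ≠ 0 ∧ IsEssentialLeftIdeal (leftAnnihilatorIdeal z)) ⟨y, hy0, hy⟩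
  refine hz0 (h.eq_zero_of_mul_mul_eq_zero fun a => ?_)
  by_contra hzaz
  have hle : leftAnnihilatorIdeal z ≤ leftAnnihilatorIdeal (z * a * z) := fun r hr => by
    rw [mem_leftAnnihilatorIdeal] at hr ⊢
    rw [← mul_assoc, ← mul_assoc, hr, zero_mul, zero_mul]
  obtain ⟨r, hr, hr0⟩ := (hz.leftAnnihilatorIdeal_mul_left a).exists_mul_mem hz0
  refine hr0 (mem_leftAnnihilatorIdeal.1 (hmax _ ⟨hzaz, hz.mono hle⟩ hle ?_))
  simpa only [mem_leftAnnihilatorIdeal, mul_assoc] using hr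

/-- In a ring of finite left uniform dimension, an element with zero left annihilator
generates an essential left ideal. -/
theorem HasFiniteLeftUniformDimension.isEssentialLeftIdeal_span {R : Type*} [Ring R]
    (h : HasFiniteLeftUniformDimension R) {x : R} (hx : ∀ r, r * x = 0 → r = 0) :
    IsEssentialLeftIdeal (Ideal.span {x}) := by
  intro J hJ hdisj
  have hpow (n : ℕ) : ∀ r, r * x ^ n = 0 → r = 0 := by
    induction n with
    | zero => simp
    | succ n ih => intro r hr; rw [pow_succ, ← mul_assoc] at hr; exact ih r (hx _ hr)
  have hsum (n : ℕ) : ∀ j : ℕ → R, (∀ i, j i ∈ J) →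
      ∑ i ∈ Finset.range n, j i * x ^ i = 0 → ∀ i < n, j i = 0 := by
    induction n with
    | zero => simp
    | succ n ih =>
      intro j hj hsum
      rw [Finset.sum_range_succ'] at hsum
      simp only [pow_succ, ← mul_assoc, ← Finset.sum_mul, pow_zero, mul_one] at hsum
      have hzero : j 0 = 0 := by
        have hmem : j 0 ∈ Ideal.span {x} ⊓ J :=
          ⟨Ideal.mem_span_singleton'.2 ⟨-∑ i ∈ Finset.range n, j (i + 1) * x ^ i, by
            rw [neg_mul]; exact neg_eq_of_add_eq_zero_right hsum⟩, hj 0⟩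
        rwa [hdisj, Submodule.mem_bot] at hmem
      rw [hzero, add_zero] at hsum
      rintro (_ | i) hi
      · exact hzero
      · exact ih (fun i => j (i + 1)) (fun i => hj _) (hx _ hsum) i (by omega)
  refine h ⟨fun n => Submodule.map (LinearMap.toSpanSingleton R R (x ^ n)) J, fun n => ?_, ?_⟩
  · obtain ⟨j, hj, hj0⟩ := (Submodule.ne_bot_iff _).1 hJ
    exact (Submodule.ne_bot_iff _).2
      ⟨j * x ^ n, Submodule.mem_map.2 ⟨j, hj, rfl⟩, fun h => hj0 (hpow n j h)⟩
  · rw [iSupIndep_iff_finsetSum_eq_zero_imp_eq_zero]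
    intro s v hv hv0 i hi
    have hcoef (i : ℕ) : ∃ r ∈ J, r * x ^ i = if i ∈ s then v i else 0 := by
      split_ifs with his
      · exact Submodule.mem_map.1 (hv i his)
      · exact ⟨0, J.zero_mem, zero_mul _⟩
    choose j hj hjv using hcoef
    obtain ⟨n, hn⟩ := s.exists_nat_subset_range
    have hji := hsum n j hj (by
      simp only [hjv]
      rw [← Finset.sum_filter, Finset.filter_mem_eq_inter, Finset.inter_eq_right.2 hn]
      exact hv0) i (Finset.mem_range.1 (hn hi))
    simpa [hji, hi] using (hjv i).symm

/-- In a semiprime left Goldie ring, an element with zero left annihilator is regular. -/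
theorem IsLeftGoldieRing.isRegular_of_mul_eq_zero {R : Type*} [Ring R]
    (hgoldie : IsLeftGoldieRing R) (hsemiprime : IsSemiprimeRing' R) {x : R}
    (hx : ∀ r, r * x = 0 → r = 0) : IsRegular x := by
  refine ⟨isLeftRegular_iff_right_eq_zero_of_mul.2 fun y hy => ?_,
    isRightRegular_iff_left_eq_zero_of_mul.2 hx⟩
  refine hsemiprime.eq_zero_of_isEssentialLeftIdeal hgoldie.2
    ((hgoldie.1.isEssentialLeftIdeal_span hx).mono ?_)
  rw [Ideal.span_le, Set.singleton_subset_iff]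
  exact mem_leftAnnihilatorIdeal.2 hy

/-- **Theorem 2.4.(1).** If `R'` is a subring of a semiprime left Goldie ring `R`
containing an essential left ideal of `R`, then the set of regular elements of `R'`
equals `C_R ∩ R'`. -/
theorem regular_elements_of_large_subring {R : Type*} [Ring R]
    (hsemiprime : IsSemiprimeRing' R) (hgoldie : IsLeftGoldieRing R)
    (R' : Subring R)
    (hlarge : ∃ I : Ideal R, IsEssentialLeftIdeal I ∧ (I : Set R) ⊆ (R' : Set R)) :
    ∀ x : R', IsRegular x ↔ IsRegular (x : R) := by
  intro x
  obtain ⟨I, hI, hIR'⟩ := hlarge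
  constructor
  · intro hx
    refine hgoldie.isRegular_of_mul_eq_zero hsemiprime fun r hr => ?_
    by_contra hr0
    obtain ⟨a, ha, ha0⟩ := hI.exists_mul_mem hr0
    have hax : (⟨a * r, hIR' ha⟩ : R') * x = 0 :=
      Subtype.ext (by simp [mul_assoc, hr])
    exact ha0 (congrArg Subtype.val (hx.right (hax.trans (zero_mul x).symm)))
  · intro hx
    exact ⟨fun a b h => Subtype.ext (hx.left (congrArg Subtype.val h)),
      fun a b h => Subtype.ext (hx.right (congrArg Subtype.val h))⟩
end

section
/- Let R be a semiprime ring with (left Gabriel–Rentschler) Krull dimension and let σ be a ring endomorphism of R with large image. Then the Krull dimension of σ(R) (as a left module over σ(R)) equals the Krull dimension of R. -/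
/-- Deviation bounds pull back along maps that preserve and reflect the order. -/
theorem DevLE.of_map {α : Ordinal.{w}} {P : Type u} {Q : Type v} [Preorder P] [Preorder Q]
    (e : P → Q) (he : ∀ x y, e x ≤ e y ↔ x ≤ y) (h : DevLE α Q) : DevLE α P := by
  induction α using WellFoundedLT.induction generalizing P Q with
  | ind α ih =>
    unfold DevLE at h ⊢
    intro f hf
    obtain ⟨N, hN⟩ := h (fun n => e (f n)) (fun n => (he _ _).2 (hf n))
    refine ⟨N, fun n hn => ?_⟩
    let g : Set.Icc (f (n + 1)) (f n) → Set.Icc (e (f (n + 1))) (e (f n)) :=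
      fun x => ⟨e x, (he _ _).2 x.2.1, (he _ _).2 x.2.2⟩
    have hg : ∀ x y, g x ≤ g y ↔ x ≤ y := fun x y => he x y
    rcases hN n hn with h | ⟨β, hβ, h⟩
    · exact Or.inl fun x y hxy => (hg _ _).1 (h _ _ ((hg _ _).2 hxy))
    · exact Or.inr ⟨β, hβ, ih β hβ g hg h⟩

theorem not_devLE_set_nat (α : Ordinal.{w}) : ¬ DevLE α (Set ℕ) := by
  induction α using WellFoundedLT.induction with
  | ind α ih =>
    intro h
    unfold DevLE at h
    let f : ℕ → Set ℕ := fun n => {m | 2 ^ n ∣ m}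
    have hf : ∀ n, f (n + 1) ≤ f n := fun n m hm => (pow_dvd_pow 2 n.le_succ).trans hm
    obtain ⟨N, hN⟩ := h f hf
    let k : ℕ → ℕ := fun i => 2 ^ N * (2 * i + 1)
    have hk : ∀ i, k i ∉ f (N + 1) := by
      intro i hi
      have : 2 ^ N * 2 ∣ 2 ^ N * (2 * i + 1) := by rw [← pow_succ]; exact hi
      have := Nat.dvd_of_mul_dvd_mul_left (by positivity) this
      omega
    have hinj : Function.Injective k := fun i j hij => by
      have := Nat.eq_of_mul_eq_mul_left (by positivity) hij
      omega
    let e : Set ℕ → Set.Icc (f (N + 1)) (f N) := fun S =>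
      ⟨f (N + 1) ∪ k '' S, Set.subset_union_left, Set.union_subset (hf N) (by
        rintro _ ⟨i, -, rfl⟩
        exact Dvd.intro _ rfl)⟩
    have he : ∀ S T, e S ≤ e T ↔ S ≤ T := by
      refine fun S T => ⟨fun hST i hi => ?_, fun hST =>
        Set.union_subset_union_right _ (Set.image_mono hST)⟩
      rcases hST (Or.inr ⟨i, hi, rfl⟩) with h | ⟨j, hj, hij⟩
      · exact absurd h (hk i)
      · exact hinj hij ▸ hj
    rcases hN N le_rfl with h | ⟨β, hβ, h⟩
    · have := (he _ _).1 (h (e ∅) (e Set.univ) ((he _ _).2 (Set.empty_subset _)))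
      exact this (Set.mem_univ 0)
    · exact ih β hβ (h.of_map e he)

/-- A lattice with deviation contains no infinite independent family. -/
theorem DevLE.exists_eq_bot_of_iSupIndep {α : Ordinal.{w}} {P : Type u} [CompleteLattice P]
    (h : DevLE α P) {V : ℕ → P} (hV : iSupIndep V) : ∃ n, V n = ⊥ := by
  by_contra! hne
  refine not_devLE_set_nat α (h.of_map (fun S : Set ℕ => ⨆ i ∈ S, V i) fun S T => ?_)
  refine ⟨fun hST k hk => ?_, fun hST => biSup_mono hST⟩
  by_contra hkT
  refine hne k (disjoint_self.1 ((hV k).mono_right ?_))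
  refine (le_biSup V hk).trans (hST.trans (iSup₂_le fun i hi => ?_))
  exact le_biSup V (show i ≠ k from fun hik => hkT (hik ▸ hi))

/-- Submodules `V n ≤ L n` with `V n` disjoint from `L (n + 1)`, for a descending chain `L`,
are independent. -/
theorem iSupIndep_of_antitone_of_disjoint {R : Type u} {M : Type v} [Ring R] [AddCommGroup M]
    [Module R M] {V L : ℕ → Submodule R M} (hL : Antitone L) (hVL : ∀ n, V n ≤ L n)
    (hd : ∀ n, Disjoint (V n) (L (n + 1))) : iSupIndep V := by
  rw [iSupIndep_iff_finsetSum_eq_zero_imp_eq_zero]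
  intro s v hv hsum i hi
  induction i using Nat.strong_induction_on with
  | _ i ih =>
    refine Submodule.disjoint_def.1 (hd i) _ (hv i hi) ?_
    rw [← Finset.add_sum_erase s v hi] at hsum
    rw [eq_neg_of_add_eq_zero_left hsum]
    refine neg_mem (sum_mem fun j hj => ?_)
    obtain ⟨hji, hj⟩ := Finset.mem_erase.1 hj
    rcases lt_or_gt_of_ne hji with hlt | hlt
    · rw [ih j hlt hj]
      exact zero_mem _
    · exact hL hlt (hVL j (hv j hj))

theorem IsSemiprimeRing'.exists_mul_ne_zero {R : Type u} [Ring R] (hR : IsSemiprimeRing' R)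
    {U : Ideal R} (hU : U ≠ ⊥) : ∃ x ∈ U, ∃ y ∈ U, x * y ≠ 0 := by
  by_contra! h
  let A : Set R := {a | ∀ y ∈ U, a * y = 0}
  have hAmul : ∀ a ∈ A, ∀ r, a * r ∈ A := fun a ha r y hy => by
    rw [mul_assoc]
    exact ha _ (U.mul_mem_left r hy)
  let B : TwoSidedIdeal R := TwoSidedIdeal.mk' {b | b ∈ A ∧ ∀ a ∈ A, a * b = 0}
    ⟨fun y _ => zero_mul y, fun a _ => mul_zero a⟩
    (fun {x y} hx hy => ⟨fun z hz => by rw [add_mul, hx.1 z hz, hy.1 z hz, add_zero],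
      fun a ha => by rw [mul_add, hx.2 a ha, hy.2 a ha, add_zero]⟩)
    (fun {x} hx => ⟨fun z hz => by rw [neg_mul, hx.1 z hz, neg_zero],
      fun a ha => by rw [mul_neg, hx.2 a ha, neg_zero]⟩)
    (fun {x y} hy => ⟨fun z hz => by rw [mul_assoc, hy.1 z hz, mul_zero],
      fun a ha => by rw [← mul_assoc, hy.2 _ (hAmul a ha x)]⟩)
    (fun {x y} hx => ⟨hAmul x hx.1 y, fun a ha => by rw [← mul_assoc, hx.2 a ha, zero_mul]⟩)
  have hB : ∀ b, b ∈ B ↔ b ∈ A ∧ ∀ a ∈ A, a * b = 0 := fun b => by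
    simp only [B, TwoSidedIdeal.mem_mk', Set.mem_ofPred_eq]
  have hbot : B = ⊥ := hR B ⟨2, two_pos, fun f hf => by
    simpa using ((hB _).1 (hf 1)).2 _ ((hB _).1 (hf 0)).1⟩
  refine hU ((Submodule.eq_bot_iff _).2 fun x hx => ?_)
  have hxB : x ∈ B := (hB x).2 ⟨h x hx, fun a ha => ha x hx⟩
  rwa [hbot, TwoSidedIdeal.mem_bot] at hxB

/-- A nonzero module with Krull dimension contains a critical submodule `U`, in the sense that
proper quotients of `U` have smaller deviation than every nonzero submodule of the module. -/
theorem DevLE.exists_critical {R : Type u} {M : Type v} [Ring R] [AddCommGroup M] [Module R M]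
    {γ : Ordinal.{w}} (h : DevLE γ (Submodule R M)) {J : Submodule R M} (hJ : J ≠ ⊥) :
    ∃ (U : Submodule R M) (α : Ordinal.{w}), U ≤ J ∧ U ≠ ⊥ ∧
      (∀ N ≤ J, N ≠ ⊥ → ∀ β < α, ¬ DevLE β (Set.Icc ⊥ N)) ∧
      ∀ V ≤ U, V ≠ ⊥ → (∀ x y : Set.Icc V U, x ≤ y → y ≤ x) ∨
        ∃ β < α, DevLE β (Set.Icc V U) := by
  let A : Set Ordinal.{w} := {α | ∃ N ≤ J, N ≠ ⊥ ∧ DevLE α (Set.Icc ⊥ N)}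
  have hA : A.Nonempty := ⟨γ, J, le_rfl, hJ, h.of_map Subtype.val fun _ _ => Iff.rfl⟩
  obtain ⟨N₀, hN₀J, hN₀, hdev⟩ := csInf_mem hA
  by_contra! hcon
  have step : ∀ N : {N : Submodule R M // N ≤ N₀ ∧ N ≠ ⊥},
      ∃ V : {N : Submodule R M // N ≤ N₀ ∧ N ≠ ⊥}, V.1 ≤ N.1 ∧
        ¬ ((∀ x y : Set.Icc V.1 N.1, x ≤ y → y ≤ x) ∨
          ∃ β < sInf A, DevLE β (Set.Icc V.1 N.1)) := by
    rintro ⟨N, hN, hN'⟩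
    obtain ⟨V, hV, hV', hx, hβ⟩ := hcon N (sInf A) (hN.trans hN₀J) hN'
      fun K hK hK' β hβ hd => notMem_of_lt_csInf' hβ ⟨K, hK, hK', hd⟩
    refine ⟨⟨V, hV.trans hN, hV'⟩, hV, ?_⟩
    rintro (h | ⟨β, hb, h⟩)
    · obtain ⟨x, y, hxy, hyx⟩ := hx
      exact hyx (h x y hxy)
    · exact hβ β hb h
  choose next hle hnext using step
  let c : ℕ → {N : Submodule R M // N ≤ N₀ ∧ N ≠ ⊥} :=
    fun n => Nat.rec ⟨N₀, le_rfl, hN₀⟩ (fun _ N => next N) n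
  unfold DevLE at hdev
  obtain ⟨N, hN⟩ := hdev (fun n => ⟨(c n).1, bot_le, (c n).2.1⟩) fun n => hle (c n)
  let e : Set.Icc (c (N + 1)).1 (c N).1 →
      Set.Icc (⟨(c (N + 1)).1, bot_le, (c (N + 1)).2.1⟩ : Set.Icc ⊥ N₀)
        ⟨(c N).1, bot_le, (c N).2.1⟩ :=
    fun x => ⟨⟨x, bot_le, x.2.2.trans (c N).2.1⟩, x.2.1, x.2.2⟩
  refine hnext (c N) ?_
  rcases hN N le_rfl with h | ⟨β, hβ, h⟩
  · exact Or.inl fun x y hxy => h (e x) (e y) hxy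
  · exact Or.inr ⟨β, hβ, h.of_map e fun _ _ => Iff.rfl⟩

/-- In a semiprime ring with Krull dimension every nonzero left ideal contains a nonzero element
`u` whose left annihilator meets `R u` trivially. -/
theorem IsSemiprimeRing'.exists_mem_ne_zero {R : Type u} [Ring R] (hR : IsSemiprimeRing' R)
    (hK : HasKrullDimGR R R) {J : Ideal R} (hJ : J ≠ ⊥) :
    ∃ u ∈ J, u ≠ 0 ∧ ∀ r, r * u * u = 0 → r * u = 0 := by
  obtain ⟨γ, hγ⟩ := hK
  obtain ⟨U, α, hUJ, hU, hmin, hcrit⟩ := hγ.exists_critical hJ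
  obtain ⟨x, hx, u, hu, hxu⟩ := hR.exists_mul_ne_zero hU
  refine ⟨u, hUJ hu, fun h => hxu (by rw [h, mul_zero]), fun r hr => ?_⟩
  let ρ : R →ₗ[R] R := LinearMap.toSpanSingleton R R u
  have hρ : ∀ a, ρ a = a * u := fun a => rfl
  by_contra hru
  have hV : U ⊓ LinearMap.ker ρ ≠ ⊥ := fun h => hru <| by
    have : r * u ∈ U ⊓ LinearMap.ker ρ := ⟨Ideal.mul_mem_left U r hu, hr⟩
    rwa [h] at this
  have hUu : U.map ρ ≤ U := by
    rintro _ ⟨a, -, rfl⟩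
    exact Ideal.mul_mem_left U a hu
  have hUu' : U.map ρ ≠ ⊥ := fun h => hxu <| by
    have : ρ x ∈ U.map ρ := ⟨x, hx, rfl⟩
    rwa [h] at this
  let e : Set.Icc ⊥ (U.map ρ) → Set.Icc (U ⊓ LinearMap.ker ρ) U :=
    fun W => ⟨U ⊓ W.1.comap ρ, inf_le_inf_left _ (LinearMap.ker_le_comap ρ), inf_le_left⟩
  have he : ∀ W W', e W ≤ e W' ↔ W ≤ W' := by
    refine fun W W' => ⟨fun h w hw => ?_, fun h => inf_le_inf_left _ (Submodule.comap_mono h)⟩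
    obtain ⟨a, ha, rfl⟩ := W.2.2 hw
    exact (h ⟨ha, hw⟩ : a ∈ U ⊓ W'.1.comap ρ).2
  rcases hcrit _ inf_le_left hV with h | ⟨β, hβ, h⟩
  · exact hUu' (le_bot_iff.1 ((he ⟨U.map ρ, bot_le, le_rfl⟩ ⟨⊥, le_rfl, bot_le⟩).1
      (h _ _ ((he _ _).2 (bot_le : ⊥ ≤ U.map ρ)))))
  · exact hmin _ (hUu.trans hUJ) hUu' β hβ (h.of_map e he)

/-- In a semiprime ring with Krull dimension every essential left ideal contains an element with
zero left annihilator. -/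
theorem IsEssentialLeftIdeal.exists_regular {R : Type u} [Ring R] (hR : IsSemiprimeRing' R)
    (hK : HasKrullDimGR R R) {I : Ideal R} (hI : IsEssentialLeftIdeal I) :
    ∃ c ∈ I, ∀ r, r * c = 0 → r = 0 := by
  by_contra! hcon
  obtain ⟨ann, hann⟩ : ∃ ann : R → Ideal R, ∀ c r, r ∈ ann c ↔ r * c = 0 :=
    ⟨fun c => LinearMap.ker (LinearMap.toSpanSingleton R R c), fun _ _ => Iff.rfl⟩
  have step : ∀ c : {c : R // c ∈ I ∧ ∀ r, r * c * c = 0 → r * c = 0},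
      ∃ (d : {c : R // c ∈ I ∧ ∀ r, r * c * c = 0 → r * c = 0}) (u : R),
        u ≠ 0 ∧ u ∈ ann c ∧ ann d ≤ ann c ∧ Disjoint (Ideal.span {u}) (ann d) := by
    rintro ⟨c, hc, hcc⟩
    obtain ⟨s, hs, hs0⟩ := hcon c hc
    have hne : ann c ≠ ⊥ := fun h => hs0 (by simpa [h] using (hann c s).2 hs)
    obtain ⟨u, hu, hu0, huu⟩ := hR.exists_mem_ne_zero hK (hI _ hne)
    have huc : u * c = 0 := (hann c u).1 hu.2
    have key : ∀ r, r * (c + u) = 0 → r * c = 0 ∧ r * u = 0 := by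
      intro r hr
      have h1 : r * c = 0 := hcc r <| by
        have := congrArg (· * c) hr
        simpa [mul_add, add_mul, mul_assoc, huc] using this
      exact ⟨h1, by simpa [mul_add, h1] using hr⟩
    refine ⟨⟨c + u, I.add_mem hc hu.1, fun r hr => ?_⟩, u, hu0, hu.2,
      fun r hr => (hann _ _).2 (key r ((hann _ _).1 hr)).1, ?_⟩
    · obtain ⟨h1, h2⟩ := key _ hr
      have h3 : r * c = 0 := hcc r (by simpa [mul_add, add_mul, mul_assoc, huc] using h1)
      have h4 : r * u = 0 := huu r (by simpa [mul_add, add_mul, h3] using h2)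
      rw [mul_add, h3, h4, add_zero]
    · refine Submodule.disjoint_def.2 fun x hx hx' => ?_
      obtain ⟨r, rfl⟩ := Ideal.mem_span_singleton'.1 hx
      exact huu r (key _ ((hann _ _).1 hx')).2
  choose next u hu0 hu hle hd using step
  obtain ⟨c, hc⟩ : ∃ c : ℕ → {c : R // c ∈ I ∧ ∀ r, r * c * c = 0 → r * c = 0},
      ∀ n, c (n + 1) = next (c n) :=
    ⟨fun n => Nat.rec ⟨0, I.zero_mem, by simp⟩ (fun _ d => next d) n, fun _ => rfl⟩
  have hind : iSupIndep fun n => Ideal.span {u (c n)} :=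
    iSupIndep_of_antitone_of_disjoint (L := fun n => ann (c n))
      (antitone_nat_of_succ_le fun n => hc n ▸ hle (c n))
      (fun n => (Ideal.span_singleton_le_iff_mem _).2 (hu (c n))) fun n => hc n ▸ hd (c n)
  obtain ⟨γ, hγ⟩ := hK
  obtain ⟨n, hn⟩ := hγ.exists_eq_bot_of_iSupIndep hind
  exact hu0 _ (Ideal.span_singleton_eq_bot.1 hn)

/-- **Proposition 2.6.** If `R` is a semiprime ring with (Gabriel–Rentschler) Krull
dimension and `σ` is an endomorphism of `R` with large image, then the Krull dimension
of `σ(R)` (as a left module over `σ(R)`) equals the Krull dimension of `R`. -/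
theorem krullDim_image_eq {R : Type u} [Ring R]
    (hsemiprime : IsSemiprimeRing' R) (hkrull : HasKrullDimGR R R)
    (σ : R →+* R) (hlarge : HasLargeImage σ) :
    krullDimGR σ.range σ.range = krullDimGR R R := by
  obtain ⟨I, hI, hIσ⟩ := hlarge
  obtain ⟨c, hc, hreg⟩ := hI.exists_regular hsemiprime hkrull
  unfold krullDimGR
  congr 1
  ext α
  constructor
  · intro h
    let e : Submodule R R → Submodule σ.range σ.range := fun W =>
      { carrier := {s | ∃ r ∈ W, r * c = s}
        zero_mem' := ⟨0, W.zero_mem, zero_mul c⟩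
        add_mem' := by
          rintro _ _ ⟨r, hr, hr'⟩ ⟨s, hs, hs'⟩
          exact ⟨r + s, W.add_mem hr hs, by rw [add_mul, hr', hs']; rfl⟩
        smul_mem' := by
          rintro a _ ⟨r, hr, hr'⟩
          exact ⟨a * r, W.smul_mem _ hr, by rw [mul_assoc, hr']; rfl⟩ }
    refine DevLE.of_map e (fun W W' => ⟨fun hW r hr => ?_, fun hW s hs => ?_⟩) h
    · obtain ⟨r', hr', heq⟩ := hW (x := ⟨r * c, hIσ (I.mul_mem_left r hc)⟩) ⟨r, hr, rfl⟩
      rwa [← sub_eq_zero.1 (hreg (r' - r) (by rw [sub_mul, heq, sub_self]))]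
    · obtain ⟨r, hr, hrs⟩ := hs
      exact ⟨r, hW hr, hrs⟩
  · exact DevLE.of_map (Ideal.comap σ.rangeRestrict) fun W W' =>
      Ideal.comap_le_comap_iff_of_surjective _ σ.rangeRestrict_surjective W W'
end

section
/- Let K be a field, let n ≥ 2, let R = K[x]/(x^{n+1}), write x̄ for the image of x in R, and let σ be the K-algebra endomorphism of R determined by σ(x̄) = x̄^n. Then σ(R) = K ⊕ K·x̄^n, σ has large image, σ is not injective with ker(σ) = (x̄²), and ker(σ) is a nilpotent ideal of R containing no regular element of R. -/
section TruncatedGenerator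

variable {K A : Type*} [Field K] [CommRing A] [Algebra K A] {t : A} {n : ℕ}

theorem algebraMap_mul_eq_zero_imp {c : K} {y : A} (hy : y ≠ 0)
    (h : algebraMap K A c * y = 0) : c = 0 := by
  rw [← Algebra.smul_def] at h
  exact (smul_eq_zero.mp h).resolve_right hy

/-- If every element of `A` is a scalar modulo the nilpotent element `t`, every nonzero element
of `A` has a nonzero scalar multiple of `t ^ n` among its multiples, where `t ^ (n + 1) = 0`. -/
theorem exists_mul_eq_algebraMap_mul_pow (h0 : t ^ (n + 1) = 0)
    (h1 : ∀ r : A, ∃ (a : K) (s : A), r = algebraMap K A a + t * s) {r : A} (hr : r ≠ 0) :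
    ∃ (u : A) (c : K), c ≠ 0 ∧ u * r = algebraMap K A c * t ^ n := by
  have key : ∀ k j : ℕ, j + k = n + 1 → ∀ s : A, t ^ j * s ≠ 0 →
      ∃ (u : A) (c : K), c ≠ 0 ∧ u * (t ^ j * s) = algebraMap K A c * t ^ n := by
    intro k
    induction k with
    | zero =>
      intro j hj s hs
      rw [show j = n + 1 by omega, h0, zero_mul] at hs
      exact absurd rfl hs
    | succ k ih =>
      intro j hj s hs
      obtain ⟨a, s', rfl⟩ := h1 s
      by_cases ha : a = 0
      · have e : t ^ j * (algebraMap K A a + t * s') = t ^ (j + 1) * s' := by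
          rw [ha, map_zero]; ring
        rw [e] at hs ⊢
        exact ih (j + 1) (by omega) s' hs
      · refine ⟨t ^ k, a, ha, ?_⟩
        obtain rfl : n = j + k := by omega
        linear_combination s' * h0
  simpa using key (n + 1) 0 (by omega) r (by simpa using hr)

theorem isEssentialLeftIdeal_span_pow (h0 : t ^ (n + 1) = 0) (ht : t ^ n ≠ 0)
    (h1 : ∀ r : A, ∃ (a : K) (s : A), r = algebraMap K A a + t * s) :
    IsEssentialLeftIdeal (Ideal.span {t ^ n}) := by
  intro J hJ hbot
  obtain ⟨r, hrJ, hr⟩ := Submodule.exists_mem_ne_zero_of_ne_bot hJ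
  obtain ⟨u, c, hc, huc⟩ := exists_mul_eq_algebraMap_mul_pow h0 h1 hr
  have hmem : algebraMap K A c * t ^ n ∈ Ideal.span {t ^ n} ⊓ J :=
    ⟨Ideal.mul_mem_left _ _ (Ideal.mem_span_singleton_self _), huc ▸ J.mul_mem_left u hrJ⟩
  rw [hbot, Ideal.mem_bot] at hmem
  exact hc (algebraMap_mul_eq_zero_imp ht hmem)

theorem pow_ne_zero_of_le_of_pow_ne_zero (ht : t ^ n ≠ 0) {m : ℕ} (hm : m ≤ n) : t ^ m ≠ 0 :=
  fun h => ht (pow_eq_zero_of_le hm h)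

theorem eq_zero_of_algebraMap_add_mul_pow_eq_zero (hn : 1 ≤ n) (h0 : t ^ (n + 1) = 0)
    (ht : t ^ n ≠ 0) {a b : K} (h : algebraMap K A a + algebraMap K A b * t ^ n = 0) :
    a = 0 ∧ b = 0 := by
  have ha : a = 0 := by
    refine algebraMap_mul_eq_zero_imp (pow_ne_zero_of_le_of_pow_ne_zero ht hn) ?_
    linear_combination t * h - algebraMap K A b * h0
  subst ha
  rw [map_zero, zero_add] at h
  exact ⟨rfl, algebraMap_mul_eq_zero_imp ht h⟩

theorem map_algebraMap_add_mul_algebraMap_add_mul (hn : 1 ≤ n) (h0 : t ^ (n + 1) = 0)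
    {σ : A →ₐ[K] A} (hσ : σ t = t ^ n) (a b : K) (s : A) :
    σ (algebraMap K A a + t * (algebraMap K A b + t * s)) =
      algebraMap K A a + algebraMap K A b * t ^ n := by
  have h2 : t ^ n * t ^ n = 0 := by
    rw [← pow_add]
    exact pow_eq_zero_of_le (by omega) h0
  simp only [map_add, map_mul, AlgHom.commutes, hσ]
  linear_combination σ s * h2

theorem mem_range_iff_of_map_eq_pow (hn : 1 ≤ n) (h0 : t ^ (n + 1) = 0)
    (h1 : ∀ r : A, ∃ (a : K) (s : A), r = algebraMap K A a + t * s)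
    {σ : A →ₐ[K] A} (hσ : σ t = t ^ n) (y : A) :
    y ∈ σ.range ↔ ∃ a b : K, y = algebraMap K A a + algebraMap K A b * t ^ n := by
  constructor
  · rintro ⟨r, rfl⟩
    obtain ⟨a, s, rfl⟩ := h1 r
    obtain ⟨b, s, rfl⟩ := h1 s
    exact ⟨a, b, map_algebraMap_add_mul_algebraMap_add_mul hn h0 hσ a b s⟩
  · rintro ⟨a, b, rfl⟩
    exact ⟨_, map_algebraMap_add_mul_algebraMap_add_mul hn h0 hσ a b 0⟩

theorem hasLargeImage_of_map_eq_pow (h0 : t ^ (n + 1) = 0) (ht : t ^ n ≠ 0)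
    (h1 : ∀ r : A, ∃ (a : K) (s : A), r = algebraMap K A a + t * s)
    {σ : A →ₐ[K] A} (hσ : σ t = t ^ n) : HasLargeImage σ.toRingHom := by
  refine ⟨Ideal.span {t ^ n}, isEssentialLeftIdeal_span_pow h0 ht h1, ?_⟩
  intro y hy
  obtain ⟨r, rfl⟩ := Ideal.mem_span_singleton'.mp hy
  obtain ⟨a, s, rfl⟩ := h1 r
  refine ⟨algebraMap K A a * t, ?_⟩
  change σ (algebraMap K A a * t) = _
  rw [map_mul, AlgHom.commutes, hσ]
  linear_combination -s * h0

theorem ker_eq_span_sq_of_map_eq_pow (hn : 1 ≤ n) (h0 : t ^ (n + 1) = 0) (ht : t ^ n ≠ 0)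
    (h1 : ∀ r : A, ∃ (a : K) (s : A), r = algebraMap K A a + t * s)
    {σ : A →ₐ[K] A} (hσ : σ t = t ^ n) :
    RingHom.ker σ.toRingHom = Ideal.span {t ^ 2} := by
  ext r
  rw [RingHom.mem_ker, Ideal.mem_span_singleton']
  change σ r = 0 ↔ _
  constructor
  · intro h
    obtain ⟨a, s, rfl⟩ := h1 r
    obtain ⟨b, s, rfl⟩ := h1 s
    rw [map_algebraMap_add_mul_algebraMap_add_mul hn h0 hσ] at h
    obtain ⟨rfl, rfl⟩ := eq_zero_of_algebraMap_add_mul_pow_eq_zero hn h0 ht h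
    exact ⟨s, by simp only [map_zero]; ring⟩
  · rintro ⟨s, rfl⟩
    have h := map_algebraMap_add_mul_algebraMap_add_mul hn h0 hσ 0 0 s
    simp only [map_zero, zero_add, zero_mul] at h
    rwa [show s * t ^ 2 = t * (t * s) by ring]

theorem not_isRegular_of_mem_span_sq (hn : 1 ≤ n) (h0 : t ^ (n + 1) = 0) (ht : t ^ n ≠ 0)
    {c : A} (hc : c ∈ Ideal.span {t ^ 2}) : ¬ IsRegular c := by
  intro hreg
  obtain ⟨s, rfl⟩ := Ideal.mem_span_singleton'.mp hc
  refine pow_ne_zero_of_le_of_pow_ne_zero ht (Nat.sub_le n 1) (hreg.left ?_)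
  obtain ⟨m, rfl⟩ := Nat.exists_eq_add_of_le' hn
  simp only [Nat.add_sub_cancel, mul_zero]
  linear_combination s * h0

end TruncatedGenerator

theorem Polynomial.exists_quotient_mk_eq_algebraMap_add_mul {K : Type*} [Field K]
    (I : Ideal (Polynomial K)) (r : Polynomial K ⧸ I) :
    ∃ (a : K) (s : Polynomial K ⧸ I),
      r = algebraMap K _ a + Ideal.Quotient.mk I Polynomial.X * s := by
  obtain ⟨p, rfl⟩ := Ideal.Quotient.mk_surjective r
  refine ⟨p.coeff 0, Ideal.Quotient.mk I p.divX, ?_⟩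
  conv_lhs => rw [← Polynomial.X_mul_divX_add p]
  rw [map_add, map_mul, add_comm]
  rfl

/-- **Example (Section 1).** Let `R = K[x]/(x^{n+1})` with `n ≥ 2`, let `x̄` be the image
of `x` in `R`, and let `σ` be the `K`-algebra endomorphism of `R` with `σ(x̄) = x̄ⁿ`.
Then `σ(R) = K ⊕ K·x̄ⁿ`, `σ` has large image, `σ` is not injective with
`ker σ = (x̄²)`, and `ker σ` is a nilpotent ideal containing no regular element. -/
theorem truncated_polynomial_endomorphism {K : Type*} [Field K] (n : ℕ) (hn : 2 ≤ n)
    (σ : (Polynomial K ⧸ Ideal.span {(Polynomial.X : Polynomial K) ^ (n + 1)}) →ₐ[K]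
         (Polynomial K ⧸ Ideal.span {(Polynomial.X : Polynomial K) ^ (n + 1)}))
    (hσ : σ (Ideal.Quotient.mk _ Polynomial.X) =
        (Ideal.Quotient.mk (Ideal.span {(Polynomial.X : Polynomial K) ^ (n + 1)})
          Polynomial.X) ^ n) :
    (∀ y, y ∈ σ.range ↔ ∃ a b : K,
        y = algebraMap K _ a + algebraMap K _ b *
          (Ideal.Quotient.mk (Ideal.span {(Polynomial.X : Polynomial K) ^ (n + 1)})
            Polynomial.X) ^ n) ∧
    HasLargeImage σ.toRingHom ∧
    ¬ Function.Injective σ ∧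
    RingHom.ker σ.toRingHom = Ideal.span
      {(Ideal.Quotient.mk (Ideal.span {(Polynomial.X : Polynomial K) ^ (n + 1)})
          Polynomial.X) ^ 2} ∧
    (∃ m : ℕ, (Ideal.span
      {(Ideal.Quotient.mk (Ideal.span {(Polynomial.X : Polynomial K) ^ (n + 1)})
          Polynomial.X) ^ 2}) ^ m = ⊥) ∧
    ∀ c ∈ RingHom.ker σ.toRingHom, ¬ IsRegular c := by
  have hn1 : 1 ≤ n := by omega
  set t := Ideal.Quotient.mk (Ideal.span {(Polynomial.X : Polynomial K) ^ (n + 1)})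
    Polynomial.X with ht_def
  have h0 : t ^ (n + 1) = 0 := by
    rw [ht_def, ← map_pow, Ideal.Quotient.eq_zero_iff_mem]
    exact Ideal.mem_span_singleton_self _
  have ht : t ^ n ≠ 0 := by
    rw [ht_def, ← map_pow, Ne, Ideal.Quotient.eq_zero_iff_mem, Ideal.mem_span_singleton,
      pow_dvd_pow_iff Polynomial.X_ne_zero Polynomial.not_isUnit_X]
    omega
  have h1 := Polynomial.exists_quotient_mk_eq_algebraMap_add_mul
    (Ideal.span {(Polynomial.X : Polynomial K) ^ (n + 1)})
  have hker := ker_eq_span_sq_of_map_eq_pow hn1 h0 ht h1 hσ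
  refine ⟨mem_range_iff_of_map_eq_pow hn1 h0 h1 hσ, hasLargeImage_of_map_eq_pow h0 ht h1 hσ,
    ?_, hker, ⟨n + 1, ?_⟩, ?_⟩
  · intro hinj
    have hmem : t ^ 2 ∈ RingHom.ker σ.toRingHom := hker ▸ Ideal.mem_span_singleton_self _
    exact pow_ne_zero_of_le_of_pow_ne_zero ht hn
      (hinj ((RingHom.mem_ker.mp hmem).trans (map_zero σ).symm))
  · rw [Ideal.span_singleton_pow, ← pow_mul, Ideal.span_singleton_eq_bot]
    exact pow_eq_zero_of_le (by omega) h0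
  · intro c hc
    exact not_isRegular_of_mem_span_sq hn1 h0 ht (hker ▸ hc)
end
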